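/- The dualizing transformation (-)* of the wire calculus is an involution preserving bisimilarity: for every wire calculus term P one has P** = P (syntactic equality of terms up to renaming of bound variables), and for closed sorted terms P, Q : (k,l) one has P ∼ Q if and only if P* ∼ Q*. -/

import Mathlib

/-!
# The wire calculus

Signals are drawn from an alphabet `Sig`; a label letter is `Option Sig`,
where `none` represents `ι` (absence of signal) and `some σ` a signal `σ ∈ Σ`.
Labels of transitions are pairs of words (lists) of such letters.
-/

namespace WireCalc

/-- Prefix atoms. `fvar n` is a free occurrence of the signal variable `n`,
`bvar n` is a binding occurrence `λn`, and `const a` is a constant: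
`const none` is `ι` and `const (some σ)` is the signal `σ ∈ Σ`. -/
inductive Atom (Sig : Type) : Type
  | fvar : ℕ → Atom Sig
  | bvar : ℕ → Atom Sig
  | const : Option Sig → Atom Sig

/-- Wire calculus terms. Process variables are de Bruijn indices;
`mu k l P` is `μY:(k,l).P`, binding index `0` in `P`.
`pre u v P` is the prefix `u/v.P`. -/
inductive Term (Sig : Type) : Type
  | pvar : ℕ → Term Sig
  | seq : Term Sig → Term Sig → Term Sig
  | ten : Term Sig → Term Sig → Term Sig
  | pre : List (Atom Sig) → List (Atom Sig) → Term Sig → Term Sig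
  | choice : Term Sig → Term Sig → Term Sig
  | mu : ℕ → ℕ → Term Sig → Term Sig

variable {Sig : Type}

def Atom.isBindOf (n : ℕ) : Atom Sig → Bool
  | .bvar m => m = n
  | _ => false

def Atom.isFreeOf (n : ℕ) : Atom Sig → Bool
  | .fvar m => m = n
  | _ => false

def Atom.isFvar : Atom Sig → Bool
  | .fvar _ => true
  | _ => false

/-- The signal variable `n` is bound by the prefix `u/v`
(i.e. `λn` occurs in `uv`). -/
def boundIn (n : ℕ) (u v : List (Atom Sig)) : Bool := (u ++ v).any (Atom.isBindOf n)

/-- The signal variable `n` occurs freely in the prefix `u/v`. -/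
def freeIn (n : ℕ) (u v : List (Atom Sig)) : Bool := (u ++ v).any (Atom.isFreeOf n)

/-- `bd(u/v)`: the set of signal variables bound by the prefix `u/v`. -/
def bdSet (u v : List (Atom Sig)) : Set ℕ := {n | boundIn n u v}

/-- `fr(u/v)`: the set of signal variables occurring freely in the prefix `u/v`. -/
def frSet (u v : List (Atom Sig)) : Set ℕ := {n | freeIn n u v}

/-- Substitution of constants for free signal variables in an atom.
`σ n = some a` means `n` is replaced by the constant `a`. -/
def Atom.substS (σ : ℕ → Option (Option Sig)) : Atom Sig → Atom Sig
  | .fvar n =>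
      match σ n with
      | some a => .const a
      | none => .fvar n
  | .bvar n => .bvar n
  | .const a => .const a

/-- Substitution of constants for free signal variables in a term;
variables bound by an inner prefix are shadowed and not substituted
under that prefix. -/
def Term.substS (σ : ℕ → Option (Option Sig)) : Term Sig → Term Sig
  | .pvar i => .pvar i
  | .seq P Q => .seq (P.substS σ) (Q.substS σ)
  | .ten P Q => .ten (P.substS σ) (Q.substS σ)
  | .pre u v P => .pre (u.map (Atom.substS σ)) (v.map (Atom.substS σ))
      (P.substS fun n => if boundIn n u v then none else σ n)
  | .choice P Q => .choice (P.substS σ) (Q.substS σ)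
  | .mu k l P => .mu k l (P.substS σ)

/-- Shifting of process variables `≥ c` by `d` (standard de Bruijn machinery). -/
def shiftP (d : ℕ) : ℕ → Term Sig → Term Sig
  | c, .pvar i => .pvar (if c ≤ i then i + d else i)
  | c, .seq P Q => .seq (shiftP d c P) (shiftP d c Q)
  | c, .ten P Q => .ten (shiftP d c P) (shiftP d c Q)
  | c, .pre u v P => .pre u v (shiftP d c P)
  | c, .choice P Q => .choice (shiftP d c P) (shiftP d c Q)
  | c, .mu k l P => .mu k l (shiftP d (c + 1) P)

/-- Capture-avoiding substitution `substP j S P = P[S / (pvar j)]` of a term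
for a process variable. -/
def substP : ℕ → Term Sig → Term Sig → Term Sig
  | j, S, .pvar i => if i = j then S else if j < i then .pvar (i - 1) else .pvar i
  | j, S, .seq P Q => .seq (substP j S P) (substP j S Q)
  | j, S, .ten P Q => .ten (substP j S P) (substP j S Q)
  | j, S, .pre u v P => .pre u v (substP j S P)
  | j, S, .choice P Q => .choice (substP j S P) (substP j S Q)
  | j, S, .mu k l P => .mu k l (substP (j + 1) (shiftP 1 0 S) P)

/-- The sorting judgement `Sorted Γ Δ P k l`, i.e. `Γ; Δ ⊢ P : (k, l)`,
where `Γ` is the (de Bruijn) context of process variables with their sorts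
and `Δ` the set of signal variables in scope. -/
inductive Sorted : List (ℕ × ℕ) → Set ℕ → Term Sig → ℕ → ℕ → Prop
  | pvar {Γ : List (ℕ × ℕ)} {Δ : Set ℕ} {i k l} :
      Γ[i]? = some (k, l) → Sorted Γ Δ (.pvar i) k l
  | seq {Γ Δ P Q k n l} : Sorted Γ Δ P k n → Sorted Γ Δ Q n l →
      Sorted Γ Δ (.seq P Q) k l
  | ten {Γ Δ P Q k l m n} : Sorted Γ Δ P k l → Sorted Γ Δ Q m n →
      Sorted Γ Δ (.ten P Q) (k + m) (l + n)
  | pre {Γ Δ u v P k l} : u.length = k → v.length = l →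
      frSet u v ∩ bdSet u v = ∅ → frSet u v ⊆ Δ →
      Sorted Γ (Δ ∪ bdSet u v) P k l → Sorted Γ Δ (.pre u v P) k l
  | choice {Γ Δ P Q k l} : Sorted Γ Δ P k l → Sorted Γ Δ Q k l →
      Sorted Γ Δ (.choice P Q) k l
  | mu {Γ Δ P k' l' k l} : Sorted ((k', l') :: Γ) Δ P k l →
      Sorted Γ Δ (.mu k' l' P) k l

/-- The word `ι⃗` of length `k`, consisting solely of `ι`'s. -/
def iotaW (Sig : Type) (k : ℕ) : List (Option Sig) := List.replicate k none

/-- A word consists solely of `ι`'s. -/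
def IsIota (w : List (Option Sig)) : Prop := ∀ x ∈ w, x = none

/-- Instantiation of a prefix atom to a label letter along a substitution `σ`
of the bound signal variables. -/
def instAtom (σ : ℕ → Option Sig) : Atom Sig → Option Sig
  | .fvar n => σ n
  | .bvar n => σ n
  | .const a => a

/-- The operational semantics of the wire calculus: `Step P a b Q` means
`P →[a/b] Q`.  The rules are Refl, ιL, ιR, Cut, Ten, Pref, +ι, +L, +R, Rec. -/
inductive Step : Term Sig → List (Option Sig) → List (Option Sig) → Term Sig → Prop
  | refl {P : Term Sig} {k l : ℕ} :
      Sorted [] ∅ P k l → Step P (iotaW Sig k) (iotaW Sig l) P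
  | iotaL {P R Q : Term Sig} {a' b' a b} :
      IsIota a' → IsIota b' → Step P a' b' R → Step R a b Q → Step P a b Q
  | iotaR {P R Q : Term Sig} {a b a' b'} :
      Step P a b R → IsIota a' → IsIota b' → Step R a' b' Q → Step P a b Q
  | cut {P Q R S : Term Sig} {a b c} :
      Step P a c Q → Step R c b S → Step (.seq P R) a b (.seq Q S)
  | ten {P Q R S : Term Sig} {a b c d} :
      Step P a b Q → Step R c d S → Step (.ten P R) (a ++ c) (b ++ d) (.ten Q S)
  | pref {u v : List (Atom Sig)} {P : Term Sig} (σ : ℕ → Option Sig)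
      (hnofree : ∀ x ∈ u ++ v, x.isFvar = false) :
      Step (.pre u v P) (u.map (instAtom σ)) (v.map (instAtom σ))
        (P.substS fun n => if boundIn n u v then some (σ n) else none)
  | choiceIota {P Q R S : Term Sig} {a b} :
      IsIota a → IsIota b → Step P a b Q → Step R a b S →
      Step (.choice P R) a b (.choice Q S)
  | choiceL {P Q R : Term Sig} {a b} :
      ¬ IsIota (a ++ b) → Step P a b Q → Step (.choice P R) a b Q
  | choiceR {P Q R : Term Sig} {a b} :
      ¬ IsIota (a ++ b) → Step R a b Q → Step (.choice P R) a b Q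
  | recur {k l : ℕ} {P Q : Term Sig} {a b} :
      Step (substP 0 (.mu k l P) P) a b Q → Step (.mu k l P) a b Q

/-- A chain of transitions with the given list of labels. -/
inductive MultiStep :
    Term Sig → List (List (Option Sig) × List (Option Sig)) → Term Sig → Prop
  | nil (P : Term Sig) : MultiStep P [] P
  | cons {P Q R : Term Sig} {a b ls} :
      Step P a b Q → MultiStep Q ls R → MultiStep P ((a, b) :: ls) R

/-- `S` is a simulation on the LTS of the wire calculus. -/
def IsSim (S : Term Sig → Term Sig → Prop) : Prop :=
  ∀ P Q, S P Q → ∀ a b P', Step P a b P' → ∃ Q', Step Q a b Q' ∧ S P' Q'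

/-- (Strong) bisimilarity `P ∼ Q` of wire calculus terms: some relation
containing `(P, Q)` is a bisimulation, i.e. it and its inverse are simulations. -/
def Bisim (P Q : Term Sig) : Prop :=
  ∃ S : Term Sig → Term Sig → Prop, IsSim S ∧ IsSim (flip S) ∧ S P Q

/-! ## Wire constants -/

/-- The word of binders `λx₁…λxₘ`. -/
def bindW (Sig : Type) (m : ℕ) : List (Atom Sig) := (List.range m).map Atom.bvar

/-- The `m`-fold identity wire `Iₘ := μY.(λx₁…λxₘ/λx₁…λxₘ).Y : (m,m)`. -/
def idW (Sig : Type) (m : ℕ) : Term Sig :=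
  .mu m m (.pre (bindW Sig m) (bindW Sig m) (.pvar 0))

/-- The symmetry (twist) wire
`X_{k,l} := μY.(λx₁…λxₖλy₁…λyₗ / λy₁…λyₗλx₁…λxₖ).Y : (k+l, l+k)`. -/
def twistW (Sig : Type) (k l : ℕ) : Term Sig :=
  .mu (k + l) (l + k)
    (.pre (bindW Sig k ++ ((List.range l).map fun i => Atom.bvar (k + i)))
          (((List.range l).map fun i => Atom.bvar (k + i)) ++ bindW Sig k)
          (.pvar 0))

/-- The wire constant `d := μY.(ε/λxλx).Y : (0,2)`. -/
def dW (Sig : Type) : Term Sig := .mu 0 2 (.pre [] [.bvar 0, .bvar 0] (.pvar 0))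

/-- The wire constant `e := μY.(λxλx/ε).Y : (2,0)`. -/
def eW (Sig : Type) : Term Sig := .mu 2 0 (.pre [.bvar 0, .bvar 0] [] (.pvar 0))

/-- The trivial term `0 := μY.Y : (0,0)`. -/
def zeroW (Sig : Type) : Term Sig := .mu 0 0 (.pvar 0)

/-- `dₙ : (0,2n)`, recursively: `d₀ := 0`, `d₁ := d`, `d_{n+1} := d;(I⊗dₙ⊗I)`. -/
def dN (Sig : Type) : ℕ → Term Sig
  | 0 => zeroW Sig
  | 1 => dW Sig
  | n + 2 => .seq (dW Sig) (.ten (.ten (idW Sig 1) (dN Sig (n + 1))) (idW Sig 1))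

/-- `eₙ : (2n,0)`, recursively: `e₀ := 0`, `e₁ := e`, `e_{n+1} := (Iₙ⊗e⊗Iₙ);eₙ`. -/
def eN (Sig : Type) : ℕ → Term Sig
  | 0 => zeroW Sig
  | 1 => eW Sig
  | n + 2 => .seq (.ten (.ten (idW Sig (n + 1)) (eW Sig)) (idW Sig (n + 1)))
      (eN Sig (n + 1))

/-- `Iₙ` with the convention `I₀ := 0`. -/
def IN (Sig : Type) : ℕ → Term Sig
  | 0 => zeroW Sig
  | n + 1 => idW Sig (n + 1)

/-- The dualizing transformation `(-)*`; on prefix strings it is reversal. -/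
def Term.star : Term Sig → Term Sig
  | .pvar i => .pvar i
  | .seq P Q => .seq Q.star P.star
  | .ten P Q => .ten Q.star P.star
  | .pre u v P => .pre v.reverse u.reverse P.star
  | .choice P Q => .choice P.star Q.star
  | .mu k l P => .mu l k P.star

end WireCalc


namespace WireCalc

variable {Sig : Type}

theorem Term.star_star (P : Term Sig) : P.star.star = P := by
  induction P <;> simp_all [Term.star]

theorem boundIn_reverse (n : ℕ) (u v : List (Atom Sig)) :
    boundIn n v.reverse u.reverse = boundIn n u v := by
  simp [boundIn, Bool.or_comm]

theorem freeIn_reverse (n : ℕ) (u v : List (Atom Sig)) :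
    freeIn n v.reverse u.reverse = freeIn n u v := by
  simp [freeIn, Bool.or_comm]

theorem bdSet_reverse (u v : List (Atom Sig)) : bdSet v.reverse u.reverse = bdSet u v := by
  simp [bdSet, boundIn_reverse]

theorem frSet_reverse (u v : List (Atom Sig)) : frSet v.reverse u.reverse = frSet u v := by
  simp [frSet, freeIn_reverse]

theorem Term.star_substS (P : Term Sig) (σ : ℕ → Option (Option Sig)) :
    (P.substS σ).star = P.star.substS σ := by
  induction P generalizing σ <;>
    simp_all [Term.star, Term.substS, boundIn_reverse, List.map_reverse]

theorem star_shiftP (d c : ℕ) (P : Term Sig) :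
    (shiftP d c P).star = shiftP d c P.star := by
  induction P generalizing c <;> simp_all [Term.star, shiftP]

theorem star_substP (j : ℕ) (S P : Term Sig) :
    (substP j S P).star = substP j S.star P.star := by
  induction P generalizing j S with
  | pvar i =>
    simp only [substP, Term.star]
    split_ifs <;> rfl
  | _ => simp_all [Term.star, substP, star_shiftP]

theorem Sorted.star {Γ : List (ℕ × ℕ)} {Δ : Set ℕ} {P : Term Sig} {k l : ℕ}
    (h : Sorted Γ Δ P k l) : Sorted (Γ.map Prod.swap) Δ P.star l k := by
  induction h with
  | pvar h => exact .pvar (by simp [h])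
  | seq _ _ ihP ihQ => exact .seq ihQ ihP
  | @ten Γ Δ P Q k l m n _ _ ihP ihQ =>
    rw [Nat.add_comm k m, Nat.add_comm l n]
    exact .ten ihQ ihP
  | pre hu hv hd hf _ ih =>
    refine .pre (by simpa using hv) (by simpa using hu) ?_ ?_ ?_
    · rwa [frSet_reverse, bdSet_reverse]
    · rwa [frSet_reverse]
    · rwa [bdSet_reverse]
  | choice _ _ ihP ihQ => exact .choice ihP ihQ
  | mu _ ih => exact .mu ih

theorem IsIota.reverse {w : List (Option Sig)} (h : IsIota w) : IsIota w.reverse :=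
  fun x hx => h x (List.mem_reverse.mp hx)

theorem not_isIota_reverse_append {a b : List (Option Sig)} (h : ¬ IsIota (a ++ b)) :
    ¬ IsIota (b.reverse ++ a.reverse) := fun h' =>
  h (by simpa using h'.reverse)

/-- The transformation `(-)*` reverses both words of a label and exchanges them. -/
theorem Step.star {P Q : Term Sig} {a b : List (Option Sig)} (h : Step P a b Q) :
    Step P.star b.reverse a.reverse Q.star := by
  induction h with
  | refl h => simpa [iotaW] using Step.refl h.star
  | iotaL ha hb _ _ ih₁ ih₂ => exact .iotaL hb.reverse ha.reverse ih₁ ih₂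
  | iotaR _ ha hb _ ih₁ ih₂ => exact .iotaR ih₁ hb.reverse ha.reverse ih₂
  | cut _ _ ih₁ ih₂ => exact .cut ih₂ ih₁
  | ten _ _ ih₁ ih₂ =>
    rw [List.reverse_append, List.reverse_append]
    exact .ten ih₂ ih₁
  | @pref u v P σ hno =>
    have h := Step.pref (u := v.reverse) (v := u.reverse) (P := P.star) σ
      (fun x hx => hno x (by simpa [or_comm] using hx))
    simpa only [Term.star, Term.star_substS, boundIn_reverse, List.map_reverse] using h
  | choiceIota ha hb _ _ ih₁ ih₂ => exact .choiceIota hb.reverse ha.reverse ih₁ ih₂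
  | choiceL h _ ih => exact .choiceL (not_isIota_reverse_append h) ih
  | choiceR h _ ih => exact .choiceR (not_isIota_reverse_append h) ih
  | recur _ ih => exact .recur (by simpa only [star_substP, Term.star] using ih)

theorem IsSim.star {S : Term Sig → Term Sig → Prop} (h : IsSim S) :
    IsSim fun P Q => S P.star Q.star := by
  intro P Q hPQ a b P' hP
  obtain ⟨Q', hQ, hS⟩ := h _ _ hPQ _ _ _ hP.star
  refine ⟨Q'.star, ?_, by simpa only [Term.star_star] using hS⟩
  simpa [Term.star_star] using hQ.star

theorem Bisim.star {P Q : Term Sig} : Bisim P Q → Bisim P.star Q.star := by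
  rintro ⟨S, hS, hS', hPQ⟩
  exact ⟨fun P Q => S P.star Q.star, hS.star, hS'.star, by simpa only [Term.star_star] using hPQ⟩

/-- `(-)*` is an involution (`P** = P`) and it preserves and
reflects bisimilarity on closed sorted terms: `P ∼ Q ↔ P* ∼ Q*`. -/
theorem star_involution_bisim (Sig : Type) :
    (∀ P : Term Sig, P.star.star = P) ∧
    (∀ (P Q : Term Sig) (k l : ℕ),
      Sorted [] ∅ P k l → Sorted [] ∅ Q k l →
      (Bisim P Q ↔ Bisim P.star Q.star)) := by
  refine ⟨Term.star_star, fun P Q _ _ _ _ => ⟨Bisim.star, fun h => ?_⟩⟩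
  simpa only [Term.star_star] using h.star

end WireCalc
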